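/- The 2l − 1 elements μ^{(1)}, μ^{(2)}, …, μ^{(l−1)}, μ^{(l)}, gμ^{(1)}, gμ^{(2)}, …, gμ^{(l−1)} of (ℤ ± x)^f are pairwise distinct f-tuples. -/

import Mathlib

open Polynomial

/-- The tuple `μ ∈ (ℤ ± x)^f`:  `μ₀ = x - 1`, `μ₁ = p - 2 - x`, and
`μ_j = p - 1 - x` for `2 ≤ j ≤ f - 1`.  Indices are taken in `ZMod f`. -/
noncomputable def muTuple (p f : ℕ) : ZMod f → Polynomial ℤ := fun j =>
  if j = 0 then X - 1
  else if j = 1 then C ((p : ℤ) - 2) - X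
  else C ((p : ℤ) - 1) - X

/-- `muIter p f k = μ^{(k)} = g^{k-1}μ ∘ ⋯ ∘ gμ ∘ μ`, with `μ^{(0)} = (x, …, x)`;
composition and the cyclic shift `g` (`(gλ)_j = λ_{j+1}`) are componentwise. -/
noncomputable def muIter (p f : ℕ) : ℕ → ZMod f → Polynomial ℤ
  | 0 => fun _ => X
  | k + 1 => fun j => (muTuple p f (j + (k : ZMod f))).comp (muIter p f k j)

/-- `msign p f k = m^{(k)} ∈ (ℤ/2)^f`: the `j`-th entry is `0` iff the leading
coefficient of `μ^{(k)}_j` is `+1`. -/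
noncomputable def msign (p f k : ℕ) (j : ZMod f) : ZMod 2 :=
  if (muIter p f k j).coeff 1 = 1 then 0 else 1

/-- `l = f` if `f` is odd and `l = 2f` if `f` is even. -/
def cycLen (f : ℕ) : ℕ := if Odd f then f else 2 * f

/-- the integer function of `μ_j` -/
def mEv (p f : ℕ) (j : ZMod f) (x : ℤ) : ℤ :=
  if j = 0 then x - 1 else if j = 1 then (p : ℤ) - 2 - x else (p : ℤ) - 1 - x

/-- the integer function of `μ^{(k)}_j` -/
def fEv (p f : ℕ) : ℕ → ZMod f → ℤ → ℤ
  | 0 => fun _ x => x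
  | k + 1 => fun j x => mEv p f (j + (k : ZMod f)) (fEv p f k j x)

/-- the sign of `μ_j` -/
def sg (f : ℕ) (j : ZMod f) : ℤ := if j = 0 then 1 else -1

/-- the sign of `μ^{(k)}_j` -/
def sgk (f : ℕ) : ℕ → ZMod f → ℤ
  | 0 => fun _ => 1
  | k + 1 => fun j => sg f (j + (k : ZMod f)) * sgk f k j

lemma fEv_eq (p f k : ℕ) (j : ZMod f) (x : ℤ) :
    (muIter p f k j).eval x = fEv p f k j x := by
  induction k with
  | zero => simp [muIter, fEv]
  | succ k ih =>
    simp only [muIter, fEv, eval_comp, ih, muTuple, mEv]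
    split_ifs <;> simp

lemma mEv_sub (p f : ℕ) (j : ZMod f) (x y : ℤ) :
    mEv p f j x - mEv p f j y = sg f j * (x - y) := by
  unfold mEv sg
  split_ifs <;> ring

lemma sg_cases (f : ℕ) (j : ZMod f) : sg f j = 1 ∨ sg f j = -1 := by
  unfold sg; split_ifs <;> simp

lemma sgk_cases (f k : ℕ) (j : ZMod f) : sgk f k j = 1 ∨ sgk f k j = -1 := by
  induction k with
  | zero => simp [sgk]
  | succ k ih =>
    simp only [sgk]
    rcases ih with h | h <;> rcases sg_cases f (j + (k : ZMod f)) with h' | h' <;> simp [h, h']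

lemma fEv_sub (p f k : ℕ) (j : ZMod f) (x y : ℤ) :
    fEv p f k j x - fEv p f k j y = sgk f k j * (x - y) := by
  induction k with
  | zero => simp [fEv, sgk]
  | succ k ih => simp only [fEv, sgk, mEv_sub, ih]; ring

lemma fEv_add (p f a b : ℕ) (j : ZMod f) (x : ℤ) :
    fEv p f (a + b) j x = fEv p f b (j + (a : ZMod f)) (fEv p f a j x) := by
  induction b with
  | zero => simp [fEv]
  | succ b ih => rw [← add_assoc]; simp only [fEv, ih]; push_cast; rw [add_assoc]

lemma fEv_one (p f : ℕ) (j : ZMod f) (x : ℤ) : fEv p f 1 j x = mEv p f j x := by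
  simp [fEv]

lemma fEv_succ' (p f k : ℕ) (j : ZMod f) (x : ℤ) :
    fEv p f k (j + 1) (mEv p f j x) = mEv p f (j + (k : ZMod f)) (fEv p f k j x) := by
  have h := fEv_add p f 1 k j x
  rw [fEv_one, add_comm 1 k] at h
  simpa [fEv] using h.symm

lemma sgk_succ' (f k : ℕ) (j : ZMod f) :
    sgk f k (j + 1) * sg f j = sg f (j + (k : ZMod f)) * sgk f k j := by
  induction k with
  | zero => simp [sgk]
  | succ k ih =>
    simp only [sgk]
    rw [mul_assoc, ih]
    push_cast
    rw [show j + 1 + (k : ZMod f) = j + ((k : ZMod f) + 1) by ring]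

lemma sg_sq (f : ℕ) (j : ZMod f) : sg f j * sg f j = 1 := by
  rcases sg_cases f j with h | h <;> simp [h]

lemma natCast_ne (f n : ℕ) (h0 : 0 < n) (h1 : n < f) : (n : ZMod f) ≠ 0 := by
  intro h
  rw [ZMod.natCast_eq_zero_iff] at h
  exact absurd (Nat.le_of_dvd h0 h) (by omega)

lemma sgk_one_low (f k : ℕ) (hk : k < f) : sgk f k 1 = (-1) ^ k := by
  induction k with
  | zero => simp [sgk]
  | succ k ih =>
    have := natCast_ne f (k + 1) (by omega) hk
    push_cast at this
    rw [add_comm] at this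
    simp only [sgk, ih (by omega), sg, if_neg this]
    ring

lemma sgk_f (f : ℕ) (hf : 1 < f) (he : ¬ Odd f) (j : ZMod f) : sgk f f j = -1 := by
  haveI : NeZero f := ⟨by omega⟩
  have step : ∀ j : ZMod f, sgk f f (j + 1) = sgk f f j := by
    intro j
    have h := sgk_succ' f f j
    rw [CharP.cast_eq_zero, add_zero] at h
    rcases sg_cases f j with h' | h' <;> rw [h'] at h <;> linarith
  have h1 : sgk f f 1 = -1 := by
    obtain ⟨n, rfl⟩ : ∃ n, f = n + 1 := ⟨f - 1, by omega⟩
    have hn : Odd n := by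
      rw [Nat.not_odd_iff_even] at he
      by_contra hn
      rw [Nat.not_odd_iff_even] at hn
      exact absurd he (by simp [Nat.even_add_one, hn])
    have hz : (1 : ZMod (n + 1)) + (n : ZMod (n + 1)) = 0 := by
      have := CharP.cast_eq_zero (ZMod (n + 1)) (n + 1)
      push_cast at this
      linear_combination this
    simp only [sgk, sgk_one_low (n + 1) n (by omega), sg, hz, if_true, hn.neg_one_pow, one_mul]
  have h0 : sgk f f 0 = -1 := by rw [← h1, ← step 0, zero_add]
  have all : ∀ n : ℕ, sgk f f (n : ZMod f) = -1 := by
    intro n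
    induction n with
    | zero => simpa using h0
    | succ n ih => push_cast; rw [step, ih]
  have := all j.val
  rwa [ZMod.natCast_zmod_val] at this

lemma main_lt (p f : ℕ) (hf : 1 < f) (hp3 : 3 < p) (k₁ k₂ : ℕ) (h1 : 1 ≤ k₁)
    (hlt : k₁ < k₂) (h2 : k₂ ≤ cycLen f)
    (h : ∀ j x, fEv p f k₁ j x = fEv p f k₂ j x) : False := by
  obtain ⟨d, rfl⟩ : ∃ d, k₂ = k₁ + d := ⟨k₂ - k₁, by omega⟩
  haveI : Fact (1 < f) := ⟨hf⟩
  have hid : ∀ j x, fEv p f d j x = x := by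
    intro j x
    have e0 := h (j - k₁)
    simp only [fEv_add, sub_add_cancel] at e0
    -- choose preimage of x
    obtain ⟨y, hy⟩ : ∃ y, fEv p f k₁ (j - k₁) y = x := by
      have q := fun y => fEv_sub p f k₁ (j - k₁) y 0
      rcases sgk_cases f k₁ (j - k₁) with s | s
      · refine ⟨x - fEv p f k₁ (j - k₁) 0, ?_⟩
        have := q (x - fEv p f k₁ (j - k₁) 0); rw [s] at this; linarith
      · refine ⟨-(x - fEv p f k₁ (j - k₁) 0), ?_⟩
        have := q (-(x - fEv p f k₁ (j - k₁) 0)); rw [s] at this; linarith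
    have := e0 y
    rw [hy] at this
    exact this.symm
  have hz : (d : ZMod f) = 0 := by
    by_contra hd
    have a := fEv_succ' p f d 0 0
    have b := fEv_succ' p f d 0 1
    simp only [hid, zero_add] at a b
    simp only [mEv, if_true, if_neg hd] at a b
    split_ifs at a b <;> omega
  rw [ZMod.natCast_eq_zero_iff] at hz
  obtain ⟨q, rfl⟩ := hz
  unfold cycLen at h2
  split_ifs at h2 with ho
  · have : q < 1 := by by_contra hq; nlinarith
    interval_cases q; omega
  · have : q < 2 := by by_contra hq; nlinarith
    interval_cases q
    · omega
    · have s := sgk_f f hf ho 0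
      have t := fEv_sub p f (f * 1) 0 1 0
      rw [hid, hid, mul_one, s] at t
      omega

lemma cross (p f : ℕ) (hf : 1 < f) (hp3 : 3 < p) (k₁ k₂ : ℕ) (h1 : 1 ≤ k₁)
    (h1' : k₁ ≤ cycLen f) (h2 : 1 ≤ k₂) (h2' : k₂ ≤ cycLen f - 1)
    (h : ∀ j x, fEv p f k₁ j x = fEv p f k₂ (j + 1) x) : False := by
  haveI : Fact (1 < f) := ⟨hf⟩
  have h10 : (1 : ZMod f) ≠ 0 := one_ne_zero
  have hff : (f : ZMod f) = 0 := CharP.cast_eq_zero _ _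
  have hs : ∀ j, sgk f k₁ j = sgk f k₂ (j + 1) := by
    intro j
    have a := fEv_sub p f k₁ j 1 0
    have b := fEv_sub p f k₂ (j + 1) 1 0
    rw [h, h] at a
    linarith
  -- commutation with the full turn
  have comm : ∀ j x, fEv p f f (j + 1) (mEv p f j x) = mEv p f j (fEv p f f j x) := by
    intro j x
    have := fEv_succ' p f f j x
    rwa [hff, add_zero] at this
  have key : ∀ j, sg f (j + k₁) * sg f j = sg f (j + 1 + k₂) * sg f (j + 1) := by
    intro j
    have a := sgk_succ' f k₁ j
    have b := sgk_succ' f k₂ (j + 1)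
    rw [← hs, ← hs] at b
    rcases sgk_cases f k₁ j with e | e <;> rcases sgk_cases f k₁ (j + 1) with e' | e' <;>
    rcases sg_cases f j with c | c <;> rcases sg_cases f (j + 1) with c' | c' <;>
    simp only [e, e', c, c'] at a b ⊢ <;> linarith
  have k0 := key 0
  have k1 := key (-1)
  have hm1 : (-1 : ZMod f) ≠ 0 := neg_ne_zero.mpr h10
  simp only [zero_add, neg_add_cancel] at k0 k1
  have cases2 : ((k₁ : ZMod f) = 0 ∧ (k₂ : ZMod f) = 0) ∨
      ((k₁ : ZMod f) = 1 ∧ 1 + (k₂ : ZMod f) = 0) := by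
    have e1 : (-1 + (k₁ : ZMod f) = 0) ↔ (k₁ : ZMod f) = 1 := by
      rw [neg_add_eq_zero, eq_comm]
    simp only [sg, if_true, if_neg h10, if_neg hm1, e1] at k0 k1
    by_cases a : (k₁ : ZMod f) = 0 <;> by_cases b : (k₂ : ZMod f) = 0 <;>
    by_cases c : (k₁ : ZMod f) = 1 <;> by_cases d : 1 + (k₂ : ZMod f) = 0 <;>
    simp_all
  rcases cases2 with ⟨a, b⟩ | ⟨a, b⟩
  · rw [ZMod.natCast_eq_zero_iff] at a b
    obtain ⟨q, rfl⟩ := a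
    obtain ⟨r, rfl⟩ := b
    unfold cycLen at h1' h2'
    split_ifs at h1' h2' with ho
    · have : r < 1 := by by_contra hq; have : f * 1 ≤ f * r := Nat.mul_le_mul_left _ (by omega)
                         omega
      interval_cases r; omega
    · have hr : r < 2 := by by_contra hq; have : f * 2 ≤ f * r := Nat.mul_le_mul_left _ (by omega)
                            omega
      have hq : q < 3 := by by_contra hq; have : f * 3 ≤ f * q := Nat.mul_le_mul_left _ (by omega)
                            omega
      have S := sgk_f f hf ho
      have T := fun j x => fEv_sub p f f j x 0
      simp only [S] at T
      have r1 : r = 1 := by interval_cases r <;> omega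
      subst r1
      simp only [mul_one] at h
      interval_cases q
      · omega
      · simp only [mul_one] at h
        have c := comm 0 0
        rw [← h] at c
        simp only [mEv, if_true] at c
        have := T 0 (0 - 1)
        omega
      · rw [mul_two] at h
        simp only [fEv_add, hff, add_zero] at h
        have a1 := h 0 0
        have a2 := h 0 1
        have t1 := T 0 (fEv p f f 0 0)
        have t2 := T 0 (fEv p f f 0 1)
        have t3 := T 0 1
        have t4 := T (0 + 1) 1
        omega
  · obtain ⟨u, rfl⟩ : ∃ u, k₁ = u + 1 := ⟨k₁ - 1, by omega⟩
    have a' : (u : ZMod f) = 0 := by push_cast at a; simpa using a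
    have b' : ((k₂ + 1 : ℕ) : ZMod f) = 0 := by push_cast; rw [add_comm]; exact b
    -- composed identity
    have H : ∀ j x, mEv p f j (fEv p f u j (mEv p f j x)) = fEv p f (k₂ + 1) j x := by
      intro j x
      have e := h j (mEv p f j x)
      rw [fEv_succ'] at e
      simp only [fEv, a', add_zero] at e ⊢
      exact e
    rw [ZMod.natCast_eq_zero_iff] at a' b'
    obtain ⟨q, rfl⟩ := a'
    obtain ⟨r, hr⟩ := b'
    rw [hr] at H
    have c00 := comm 0 0
    simp only [zero_add] at c00
    unfold cycLen at h1' h2'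
    split_ifs at h1' h2' with ho
    · have hr2 : r < 2 := by by_contra hq; have : f * 2 ≤ f * r := Nat.mul_le_mul_left _ (by omega)
                             omega
      have hq : q < 1 := by by_contra hq; have : f * 1 ≤ f * q := Nat.mul_le_mul_left _ (by omega)
                            omega
      have r1 : r = 1 := by interval_cases r <;> omega
      subst r1
      interval_cases q
      simp only [mul_zero, mul_one, fEv] at H
      rw [← H, ← H] at c00
      simp only [mEv, if_true, if_neg h10] at c00
      omega
    · have hr2 : r < 3 := by by_contra hq; have : f * 3 ≤ f * r := Nat.mul_le_mul_left _ (by omega)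
                             omega
      have hq : q < 2 := by by_contra hq; have : f * 2 ≤ f * q := Nat.mul_le_mul_left _ (by omega)
                            omega
      have S := sgk_f f hf ho
      have T := fun j x => fEv_sub p f f j x 0
      simp only [S] at T
      have r0 : r ≠ 0 := by rintro rfl; omega
      have H0 := H 0 0
      have H01 := H 0 1
      have H1 := H 1 0
      have H2 := H (1 + 1) 0
      have c10 := comm 1 0
      simp only [mEv, if_true, if_neg h10] at H0 H01 H1 c00 c10
      interval_cases q <;> interval_cases r
      · exact r0 rfl
      · simp only [mul_zero, mul_one, fEv] at H0 H01
        have := T 0 1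
        omega
      · simp only [mul_zero, mul_two, fEv_add, hff, add_zero, fEv] at H0
        have := T 0 (fEv p f f 0 0)
        omega
      · exact r0 rfl
      · simp only [mul_one] at H1 H2
        have t1 := T 0 (0 - 1)
        have t2 := T 1 (0 - 1)
        have t3 := T 1 ((p : ℤ) - 2 - 0)
        have t4 := T (1 + 1) ((p : ℤ) - 2 - 0)
        by_cases hz : (1 + 1 : ZMod f) = 0
        · rw [hz] at c10 t4
          omega
        · have h21 : (1 + 1 : ZMod f) ≠ 1 := by
            intro h; exact h10 (by simpa using h)
          simp only [mEv, if_neg hz, if_neg h21] at H2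
          have t5 := T (1 + 1) ((p : ℤ) - 1 - 0)
          omega
      · simp only [mul_one, mul_two, fEv_add, hff, add_zero] at H0 H01
        have t1 := T 0 (0 - 1)
        have t2 := T 0 (1 - 1)
        have t3 := T 0 (fEv p f f 0 0)
        have t4 := T 0 (fEv p f f 0 1)
        have t5 := T 0 1
        omega

/-- Lemma 2.2: the `2l - 1` tuples `μ^{(1)}, …, μ^{(l)}, gμ^{(1)}, …, gμ^{(l-1)}`
are pairwise distinct elements of `(ℤ ± x)^f`. -/
theorem muIter_and_shifts_pairwise_distinct (p f : ℕ)
    (hp : p.Prime) (hp3 : 3 < p) (hf : 1 < f) :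
    (∀ k₁ k₂ : ℕ, 1 ≤ k₁ → k₁ ≤ cycLen f → 1 ≤ k₂ → k₂ ≤ cycLen f → k₁ ≠ k₂ →
      muIter p f k₁ ≠ muIter p f k₂) ∧
    (∀ k₁ k₂ : ℕ, 1 ≤ k₁ → k₁ ≤ cycLen f - 1 → 1 ≤ k₂ → k₂ ≤ cycLen f - 1 → k₁ ≠ k₂ →
      (fun j : ZMod f => muIter p f k₁ (j + 1)) ≠
        (fun j : ZMod f => muIter p f k₂ (j + 1))) ∧
    (∀ k₁ k₂ : ℕ, 1 ≤ k₁ → k₁ ≤ cycLen f → 1 ≤ k₂ → k₂ ≤ cycLen f - 1 →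
      muIter p f k₁ ≠ (fun j : ZMod f => muIter p f k₂ (j + 1))) := by
  have toF : ∀ (k₁ k₂ : ℕ) (j i : ZMod f), muIter p f k₁ j = muIter p f k₂ i →
      ∀ x, fEv p f k₁ j x = fEv p f k₂ i x := by
    intro k₁ k₂ j i h x
    rw [← fEv_eq, ← fEv_eq, h]
  have first : ∀ k₁ k₂ : ℕ, 1 ≤ k₁ → k₁ ≤ cycLen f → 1 ≤ k₂ → k₂ ≤ cycLen f → k₁ ≠ k₂ →
      ¬ ∀ j, muIter p f k₁ j = muIter p f k₂ j := by
    intro k₁ k₂ a b c d hne h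
    rcases lt_or_gt_of_ne hne with hl | hl
    · exact main_lt p f hf hp3 k₁ k₂ a hl d fun j => toF _ _ _ _ (h j)
    · exact main_lt p f hf hp3 k₂ k₁ c hl b fun j => toF _ _ _ _ (h j).symm
  refine ⟨?_, ?_, ?_⟩
  · intro k₁ k₂ a b c d hne h
    exact first k₁ k₂ a b c d hne fun j => congrFun h j
  · intro k₁ k₂ a b c d hne h
    refine first k₁ k₂ a (by omega) c (by omega) hne fun j => ?_
    have := congrFun h (j - 1)
    simpa using this
  · intro k₁ k₂ a b c d h
    exact cross p f hf hp3 k₁ k₂ a b c d fun j => toF _ _ _ _ (congrFun h j)
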